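/- Consider the TPSC-Student-t modal regression model: for an n × p real design matrix X of full rank with p ≤ n and finite entries, with rows X₁ᵀ, …, X_nᵀ, observations y₁, …, y_n ∈ ℝ, the likelihood ∏_{i=1}^{n} f_TPSC(y_i | w, X_iᵀβ, σ, δ), the Uniform(0,1) prior density on w, independent InverseGamma(1,1) prior densities p(x) = x^{−2} e^{−1/x} on σ > 0 and δ > 0, and the flat prior p(β) ∝ 1 on β ∈ ℝ^p. Then the posterior distribution is proper, i.e., the integral of the likelihood times the prior densities over (β, w, σ, δ) ∈ ℝ^p × (0,1) × (0,∞)² is finite. -/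

import Mathlib

open MeasureTheory

/-- The standardized Student-t density with degrees of freedom `δ`. -/
noncomputable def gStudent (δ z : ℝ) : ℝ :=
  Real.Gamma ((δ + 1) / 2) / (Real.Gamma (δ / 2) * Real.sqrt (δ * Real.pi)) *
    (1 + z ^ 2 / δ) ^ (-(δ + 1) / 2)

/-- The TPSC-Student-t density with weight `w`, mode `θ`, scale `σ`, and shape `δ`. -/
noncomputable def fTPSC (w θ σ δ y : ℝ) : ℝ :=
  if y < θ then w * (2 / (σ * Real.sqrt (w / (1 - w)))) *
      gStudent δ ((y - θ) / (σ * Real.sqrt (w / (1 - w))))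
  else (1 - w) * (2 / (σ * Real.sqrt ((1 - w) / w))) *
      gStudent δ ((y - θ) / (σ * Real.sqrt ((1 - w) / w)))

/-- The InverseGamma(1,1) density. -/
noncomputable def invGamma11 (x : ℝ) : ℝ := x ^ (-2 : ℝ) * Real.exp (-1 / x)

theorem lintegral_fin_prod_eq_prod_lintegral {p : ℕ} (f : Fin p → ℝ → ENNReal)
    (hf : ∀ i, Measurable (f i)) :
    ∫⁻ x : Fin p → ℝ, ∏ i, f i (x i) = ∏ i, ∫⁻ t, f i t := by
  induction p with
  | zero => simp [lintegral_unique, volume_pi]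
  | succ p ih =>
    rw [Fin.prod_univ_succ, ← ih _ fun i => hf i.succ,
      ← lintegral_prod_mul (hf 0).aemeasurable
        (Finset.measurable_prod _ fun i _ =>
          (hf i.succ).comp (measurable_pi_apply i)).aemeasurable,
      ← (volume_preserving_piFinSuccAbove (fun _ : Fin (p + 1) => ℝ) 0).symm.lintegral_comp_emb
        (MeasurableEquiv.measurableEmbedding _)]
    rw [← Measure.volume_eq_prod]
    refine lintegral_congr fun x => ?_
    simp [MeasurableEquiv.piFinSuccAbove_symm_apply, Fin.prod_univ_succ, Fin.insertNthEquiv]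

theorem Matrix.lintegral_prod_comp_mulVec {p : ℕ} (A : Matrix (Fin p) (Fin p) ℝ)
    (hA : A.det ≠ 0) (f : Fin p → ℝ → ENNReal) (hf : ∀ i, Measurable (f i)) :
    ∫⁻ x : Fin p → ℝ, ∏ i, f i (∑ j, A i j * x j) =
      ENNReal.ofReal |A.det⁻¹| * ∏ i, ∫⁻ t, f i t := by
  rw [← lintegral_fin_prod_eq_prod_lintegral f hf, ← smul_eq_mul, ← lintegral_smul_measure,
    ← Real.map_matrix_volume_pi_eq_smul_volume_pi hA,
    lintegral_map (by fun_prop) (LinearMap.continuous_of_finiteDimensional _).measurable]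
  simp [Matrix.toLin'_apply, Matrix.mulVec, dotProduct]

theorem Matrix.exists_submatrix_det_ne_zero {n p : ℕ} (X : Matrix (Fin n) (Fin p) ℝ)
    (hX : X.rank = p) : ∃ e : Fin p ↪ Fin n, (X.submatrix e id).det ≠ 0 := by
  obtain ⟨κ, a, ha, hspan, hli⟩ := exists_linearIndependent' ℝ X.row
  have : Fintype κ := @Fintype.ofFinite κ (Finite.of_injective a ha)
  have hcard : Fintype.card κ = Fintype.card (Fin p) := by
    rw [linearIndependent_iff_card_eq_finrank_span.mp hli, Set.finrank, hspan,
      ← X.rank_eq_finrank_span_row, hX, Fintype.card_fin]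
  let c := (Fintype.equivOfCardEq hcard).symm
  refine ⟨⟨a ∘ c, ha.comp c.injective⟩, ?_⟩
  rw [← isUnit_iff_ne_zero, ← Matrix.isUnit_iff_isUnit_det,
    ← Matrix.linearIndependent_rows_iff_isUnit]
  exact hli.comp c c.injective

theorem Real.Gamma_add_half_le {x : ℝ} (hx : 0 < x) :
    Real.Gamma (x + 1 / 2) ≤ Real.Gamma x * √x := by
  have hG := (Real.Gamma_pos_of_pos hx).le
  have h := Real.Gamma_mul_add_mul_le_rpow_Gamma_mul_rpow_Gamma hx (by positivity : 0 < x + 1)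
    (by norm_num : (0 : ℝ) < 1 / 2) (by norm_num : (0 : ℝ) < 1 / 2) (by norm_num)
  rw [← Real.sqrt_eq_rpow, ← Real.sqrt_eq_rpow, ← Real.sqrt_mul hG, Real.Gamma_add_one hx.ne',
    show Real.Gamma x * (x * Real.Gamma x) = Real.Gamma x ^ 2 * x by ring,
    Real.sqrt_mul (sq_nonneg _), Real.sqrt_sq hG] at h
  convert h using 2
  ring

theorem gStudent_nonneg {δ : ℝ} (hδ : 0 < δ) (z : ℝ) : 0 ≤ gStudent δ z := by
  have := Real.Gamma_pos_of_pos (half_pos hδ)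
  have := Real.Gamma_pos_of_pos (by positivity : 0 < (δ + 1) / 2)
  unfold gStudent
  positivity

theorem gStudent_le_one {δ : ℝ} (hδ : 0 < δ) (z : ℝ) : gStudent δ z ≤ 1 := by
  have h1 := Real.Gamma_pos_of_pos (half_pos hδ)
  have hz : 0 ≤ z ^ 2 / δ := by positivity
  refine mul_le_one₀ ?_ (by positivity)
    (Real.rpow_le_one_of_one_le_of_nonpos (by linarith) (by linarith))
  rw [div_le_one (by positivity), show (δ + 1) / 2 = δ / 2 + 1 / 2 by ring]
  refine (Real.Gamma_add_half_le (half_pos hδ)).trans ?_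
  gcongr
  nlinarith [Real.pi_gt_three]

theorem measurable_gStudent (δ : ℝ) : Measurable (gStudent δ) := by
  unfold gStudent
  fun_prop

/-- The Student density as a Gamma mixture of Gaussian functions. -/
theorem ofReal_gStudent_eq_lintegral {δ : ℝ} (hδ : 0 < δ) (z : ℝ) :
    ENNReal.ofReal (gStudent δ z) = ∫⁻ t in Set.Ioi (0 : ℝ),
      ENNReal.ofReal (1 / (Real.Gamma (δ / 2) * √(δ * Real.pi)) *
        (t ^ ((δ + 1) / 2 - 1) * Real.exp (-((1 + z ^ 2 / δ) * t)))) := by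
  have hr : 0 < 1 + z ^ 2 / δ := by positivity
  have hG := Real.Gamma_pos_of_pos (half_pos hδ)
  have ha : 0 < (δ + 1) / 2 := by positivity
  have hint := Real.integral_rpow_mul_exp_neg_mul_Ioi ha hr
  have hGa := Real.Gamma_pos_of_pos ha
  rw [← ofReal_integral_eq_lintegral_ofReal, integral_const_mul, hint]
  · rw [gStudent, one_div (1 + z ^ 2 / δ), Real.inv_rpow hr.le, ← Real.rpow_neg hr.le,
      neg_div]
    congr 1
    ring
  · refine (Integrable.of_integral_ne_zero ?_).const_mul _
    rw [hint]
    positivity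
  · filter_upwards [ae_restrict_mem measurableSet_Ioi] with t (ht : 0 < t)
    simp only [Pi.zero_apply]
    positivity

theorem lintegral_gStudent {δ : ℝ} (hδ : 0 < δ) :
    ∫⁻ z, ENNReal.ofReal (gStudent δ z) = 1 := by
  have hG := Real.Gamma_pos_of_pos (half_pos hδ)
  simp_rw [ofReal_gStudent_eq_lintegral hδ]
  rw [lintegral_lintegral_swap (by unfold Function.uncurry; fun_prop)]
  have hint := Real.integral_rpow_mul_exp_neg_mul_Ioi (half_pos hδ) one_pos
  have key : ∀ t ∈ Set.Ioi (0 : ℝ), ∫⁻ z : ℝ,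
      ENNReal.ofReal (1 / (Real.Gamma (δ / 2) * √(δ * Real.pi)) *
        (t ^ ((δ + 1) / 2 - 1) * Real.exp (-((1 + z ^ 2 / δ) * t)))) =
      ENNReal.ofReal (1 / Real.Gamma (δ / 2) *
        (t ^ (δ / 2 - 1) * Real.exp (-(1 * t)))) := by
    intro t (ht : 0 < t)
    have hb : 0 < t / δ := by positivity
    have h : ∀ z : ℝ, 1 / (Real.Gamma (δ / 2) * √(δ * Real.pi)) *
        (t ^ ((δ + 1) / 2 - 1) * Real.exp (-((1 + z ^ 2 / δ) * t))) =
        (1 / (Real.Gamma (δ / 2) * √(δ * Real.pi)) * (t ^ ((δ + 1) / 2 - 1) *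
          Real.exp (-(1 * t)))) * Real.exp (-(t / δ) * z ^ 2) := by
      intro z
      rw [show -((1 + z ^ 2 / δ) * t) = -(1 * t) + -(t / δ) * z ^ 2 by ring, Real.exp_add]
      ring
    simp_rw [h]
    rw [← ofReal_integral_eq_lintegral_ofReal ((integrable_exp_neg_mul_sq hb).const_mul _)
      (ae_of_all _ fun z => by positivity), integral_const_mul, integral_gaussian]
    congr 1
    have hs : √(Real.pi / (t / δ)) = √(δ * Real.pi) * t ^ (-(1 / 2) : ℝ) := by
      rw [Real.rpow_neg ht.le, ← Real.sqrt_eq_rpow, ← Real.sqrt_inv, ← Real.sqrt_mul (by positivity)]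
      congr 1
      field_simp
    rw [hs, show δ / 2 - 1 = ((δ + 1) / 2 - 1) + (-(1 / 2)) by ring, Real.rpow_add ht]
    have : 0 < √(δ * Real.pi) := by positivity
    field_simp
  rw [setLIntegral_congr_fun measurableSet_Ioi key, ← ofReal_integral_eq_lintegral_ofReal,
    integral_const_mul, hint]
  · simp [hG.ne']
  · refine (Integrable.of_integral_ne_zero ?_).const_mul _
    rw [hint]
    positivity
  · filter_upwards [ae_restrict_mem measurableSet_Ioi] with t (ht : 0 < t)
    simp only [Pi.zero_apply]
    positivity

theorem lintegral_gStudent_location_scale {δ s : ℝ} (hδ : 0 < δ) (hs : 0 < s) (y : ℝ) :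
    ∫⁻ θ, ENNReal.ofReal (gStudent δ ((y - θ) / s)) = ENNReal.ofReal s := by
  have hm := measurable_gStudent δ
  rw [lintegral_sub_left_eq_self (fun x => ENNReal.ofReal (gStudent δ (x / s))) y]
  have h := lintegral_map (μ := volume) (f := fun z => ENNReal.ofReal (gStudent δ z))
    (by fun_prop) (measurable_const_mul s⁻¹)
  rw [Real.map_volume_mul_left (inv_ne_zero hs.ne'), lintegral_smul_measure,
    lintegral_gStudent hδ, inv_inv, abs_of_pos hs, smul_eq_mul, mul_one] at h
  simp_rw [div_eq_inv_mul]
  exact h.symm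

theorem measurable_fTPSC (w σ δ y : ℝ) : Measurable fun θ => fTPSC w θ σ δ y := by
  have := measurable_gStudent δ
  unfold fTPSC
  exact Measurable.ite measurableSet_Ioi (by fun_prop) (by fun_prop)

theorem fTPSC_nonneg {w σ δ : ℝ} (hw : w ∈ Set.Ioo (0 : ℝ) 1) (hσ : 0 < σ) (hδ : 0 < δ)
    (θ y : ℝ) : 0 ≤ fTPSC w θ σ δ y := by
  have hw0 := hw.1
  have hw1 : 0 < 1 - w := sub_pos.2 hw.2
  unfold fTPSC
  split_ifs
  · have := gStudent_nonneg hδ ((y - θ) / (σ * √(w / (1 - w))))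
    positivity
  · have := gStudent_nonneg hδ ((y - θ) / (σ * √((1 - w) / w)))
    positivity

theorem mul_two_div_mul_sqrt_le {a b σ : ℝ} (ha : 0 < a) (hb : 0 < b) (hab : a + b = 1)
    (hσ : 0 < σ) : a * (2 / (σ * √(a / b))) ≤ 2 / σ := by
  have h : a ≤ √(a / b) := by
    apply Real.le_sqrt_of_sq_le
    rw [le_div_iff₀ hb]
    nlinarith [mul_pos ha hb, mul_pos ha (mul_pos ha hb), mul_pos ha ha]
  have hs : 0 < √(a / b) := by positivity
  calc a * (2 / (σ * √(a / b))) = (2 / σ) * (a / √(a / b)) := by field_simp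
    _ ≤ 2 / σ := mul_le_of_le_one_right (by positivity) ((div_le_one hs).2 h)

theorem fTPSC_le {w σ δ : ℝ} (hw : w ∈ Set.Ioo (0 : ℝ) 1) (hσ : 0 < σ) (hδ : 0 < δ)
    (θ y : ℝ) : fTPSC w θ σ δ y ≤ 2 / σ := by
  have hw0 := hw.1
  have hw1 : 0 < 1 - w := sub_pos.2 hw.2
  unfold fTPSC
  split_ifs
  · exact (mul_le_of_le_one_right (by positivity) (gStudent_le_one hδ _)).trans
      (mul_two_div_mul_sqrt_le hw0 hw1 (by ring) hσ)
  · exact (mul_le_of_le_one_right (by positivity) (gStudent_le_one hδ _)).trans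
      (mul_two_div_mul_sqrt_le hw1 hw0 (by ring) hσ)

theorem lintegral_const_mul_gStudent_location_scale {a δ s : ℝ} (ha : 0 ≤ a) (hδ : 0 < δ)
    (hs : 0 < s) (y : ℝ) :
    ∫⁻ θ, ENNReal.ofReal (a * (2 / s) * gStudent δ ((y - θ) / s)) = ENNReal.ofReal (2 * a) := by
  have h0 : 0 ≤ a * (2 / s) := by positivity
  simp_rw [ENNReal.ofReal_mul h0]
  rw [lintegral_const_mul' _ _ ENNReal.ofReal_ne_top, lintegral_gStudent_location_scale hδ hs,
    ← ENNReal.ofReal_mul h0]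
  congr 1
  field_simp

theorem lintegral_fTPSC_le {w σ δ : ℝ} (hw : w ∈ Set.Ioo (0 : ℝ) 1) (hσ : 0 < σ) (hδ : 0 < δ)
    (y : ℝ) : ∫⁻ θ, ENNReal.ofReal (fTPSC w θ σ δ y) ≤ 2 := by
  have hw0 := hw.1
  have hw1 : 0 < 1 - w := sub_pos.2 hw.2
  have hm := measurable_gStudent δ
  calc ∫⁻ θ, ENNReal.ofReal (fTPSC w θ σ δ y)
      ≤ ∫⁻ θ, (ENNReal.ofReal (w * (2 / (σ * √(w / (1 - w)))) *
            gStudent δ ((y - θ) / (σ * √(w / (1 - w))))) +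
          ENNReal.ofReal ((1 - w) * (2 / (σ * √((1 - w) / w))) *
            gStudent δ ((y - θ) / (σ * √((1 - w) / w))))) := by
        refine lintegral_mono fun θ => ?_
        unfold fTPSC
        split_ifs
        · exact le_self_add
        · exact le_add_self
    _ = 2 := by
        rw [lintegral_add_left (by fun_prop),
          lintegral_const_mul_gStudent_location_scale hw0.le hδ (by positivity),
          lintegral_const_mul_gStudent_location_scale hw1.le hδ (by positivity),
          ← ENNReal.ofReal_add (by positivity) (by positivity)]
        ring_nf
        simp

theorem invGamma11_nonneg {x : ℝ} (hx : 0 < x) : 0 ≤ invGamma11 x := by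
  unfold invGamma11
  positivity

theorem lintegral_const_div_pow_mul_invGamma11_lt_top {c : ℝ} (hc : 0 ≤ c) (m : ℕ) :
    ∫⁻ x in Set.Ioi (0 : ℝ), ENNReal.ofReal ((c / x) ^ m * invGamma11 x) < ⊤ := by
  have hrw : ∀ x : ℝ, 0 < x →
      (c / x) ^ m * invGamma11 x = c ^ m * ((1 / x) ^ (m + 2) * Real.exp (-(1 / x))) := by
    intro x hx
    rw [invGamma11, Real.rpow_neg hx.le, Real.rpow_two, neg_div, div_pow, div_pow]
    field_simp
    simp [pow_add, mul_assoc]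
  have hsplit : Set.Ioi (0 : ℝ) = Set.Ioc 0 1 ∪ Set.Ioi 1 :=
    (Set.Ioc_union_Ioi_eq_Ioi zero_le_one).symm
  rw [hsplit]
  refine (lintegral_union_le _ _ _).trans_lt (ENNReal.add_lt_top.2 ⟨?_, ?_⟩)
  · refine (setLIntegral_mono' (g := fun _ => ENNReal.ofReal (c ^ m * (m + 2).factorial))
      measurableSet_Ioc fun x hx => ENNReal.ofReal_le_ofReal ?_).trans_lt ?_
    · rw [hrw x hx.1]
      gcongr
      have := Real.pow_div_factorial_le_exp (x := 1 / x) (one_div_nonneg.2 hx.1.le) (m + 2)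
      rw [div_le_iff₀ (by positivity)] at this
      rw [Real.exp_neg, ← div_eq_mul_inv, div_le_iff₀ (Real.exp_pos _), mul_comm]
      exact this
    · simp
  · refine (setLIntegral_mono' (g := fun x => ENNReal.ofReal (c ^ m * x ^ (-2 : ℝ)))
      measurableSet_Ioi fun x (hx : 1 < x) => ENNReal.ofReal_le_ofReal ?_).trans_lt ?_
    · have hx0 : 0 < x := by linarith
      rw [hrw x hx0, Real.rpow_neg hx0.le, Real.rpow_two]
      gcongr
      have h1 : 1 / x ≤ 1 := (div_le_one hx0).2 hx.le
      calc (1 / x) ^ (m + 2) * Real.exp (-(1 / x)) ≤ (1 / x) ^ 2 * 1 := by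
            refine mul_le_mul (pow_le_pow_of_le_one (by positivity) h1 (by omega))
              (Real.exp_le_one_iff.2 (neg_nonpos.2 (by positivity))) ?_ ?_ <;> positivity
        _ = (x ^ 2)⁻¹ := by simp
    · exact ((integrableOn_Ioi_rpow_of_lt (by norm_num : (-2 : ℝ) < -1)
        one_pos).const_mul _).lintegral_lt_top

theorem lintegral_prod_fTPSC_le {n p : ℕ} (X : Matrix (Fin n) (Fin p) ℝ) (y : Fin n → ℝ)
    (e : Fin p ↪ Fin n) (he : (X.submatrix e id).det ≠ 0) {w σ δ : ℝ}
    (hw : w ∈ Set.Ioo (0 : ℝ) 1) (hσ : 0 < σ) (hδ : 0 < δ) :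
    ∫⁻ β : Fin p → ℝ, ENNReal.ofReal (∏ i, fTPSC w (∑ j, X i j * β j) σ δ (y i)) ≤
      ENNReal.ofReal |(X.submatrix e id).det⁻¹| * 2 ^ p *
        ENNReal.ofReal ((2 / σ) ^ (n - p)) := by
  have hle : ∀ β : Fin p → ℝ, ENNReal.ofReal (∏ i, fTPSC w (∑ j, X i j * β j) σ δ (y i)) ≤
      (∏ k, ENNReal.ofReal (fTPSC w (∑ j, X.submatrix e id k j * β j) σ δ (y (e k)))) *
        ENNReal.ofReal ((2 / σ) ^ (n - p)) := by
    intro β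
    rw [ENNReal.ofReal_prod_of_nonneg fun i _ => fTPSC_nonneg hw hσ hδ _ _,
      ← Finset.prod_mul_prod_compl (Finset.univ.map e), Finset.prod_map]
    refine mul_le_mul_right ?_ _
    refine (Finset.prod_le_pow_card _ _ (ENNReal.ofReal (2 / σ))
      fun i _ => ENNReal.ofReal_le_ofReal (fTPSC_le hw hσ hδ _ _)).trans_eq ?_
    rw [Finset.card_compl, Finset.card_map, Finset.card_univ, Fintype.card_fin, Fintype.card_fin,
      ENNReal.ofReal_pow (by positivity)]
  refine (lintegral_mono hle).trans ?_
  rw [lintegral_mul_const' _ _ ENNReal.ofReal_ne_top,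
    Matrix.lintegral_prod_comp_mulVec _ he
      (fun k θ => ENNReal.ofReal (fTPSC w θ σ δ (y (e k))))
      fun k => (measurable_fTPSC w σ δ _).ennreal_ofReal]
  gcongr
  refine (Finset.prod_le_pow_card _ _ 2 fun k _ => lintegral_fTPSC_le hw hσ hδ _).trans_eq ?_
  simp

/-- Posterior propriety of the TPSC-Student-t modal regression model. -/
theorem posterior_propriety_TPSC_Student_t
    (n p : ℕ) (hpn : p ≤ n)
    (X : Matrix (Fin n) (Fin p) ℝ) (hrank : X.rank = p)
    (y : Fin n → ℝ) :
    ∫⁻ w in Set.Ioo (0:ℝ) 1, ∫⁻ σ in Set.Ioi (0:ℝ), ∫⁻ δ in Set.Ioi (0:ℝ),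
      ∫⁻ β : Fin p → ℝ,
        ENNReal.ofReal ((∏ i, fTPSC w (∑ j, X i j * β j) σ δ (y i)) *
          invGamma11 σ * invGamma11 δ) < ⊤ := by
  obtain ⟨e, he⟩ := X.exists_submatrix_det_ne_zero hrank
  set C : ENNReal := ENNReal.ofReal |(X.submatrix e id).det⁻¹| * 2 ^ p
  have hC : C ≠ ⊤ := ENNReal.mul_ne_top ENNReal.ofReal_ne_top (by simp)
  set I : ENNReal := ∫⁻ δ in Set.Ioi (0 : ℝ), ENNReal.ofReal (invGamma11 δ)
  have hI : I ≠ ⊤ := by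
    simpa [I] using (lintegral_const_div_pow_mul_invGamma11_lt_top zero_le_two 0).ne
  set J : ENNReal := ∫⁻ σ in Set.Ioi (0 : ℝ),
    ENNReal.ofReal ((2 / σ) ^ (n - p) * invGamma11 σ)
  have hJ : J ≠ ⊤ := (lintegral_const_div_pow_mul_invGamma11_lt_top zero_le_two _).ne
  have hβ : ∀ w ∈ Set.Ioo (0 : ℝ) 1, ∀ σ ∈ Set.Ioi (0 : ℝ), ∀ δ ∈ Set.Ioi (0 : ℝ),
      ∫⁻ β : Fin p → ℝ, ENNReal.ofReal ((∏ i, fTPSC w (∑ j, X i j * β j) σ δ (y i)) *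
        invGamma11 σ * invGamma11 δ) ≤
      C * ENNReal.ofReal ((2 / σ) ^ (n - p) * invGamma11 σ) *
        ENNReal.ofReal (invGamma11 δ) := by
    intro w hw σ (hσ : 0 < σ) δ (hδ : 0 < δ)
    have h0 : ∀ β : Fin p → ℝ, 0 ≤ ∏ i, fTPSC w (∑ j, X i j * β j) σ δ (y i) :=
      fun β => Finset.prod_nonneg fun i _ => fTPSC_nonneg hw hσ hδ _ _
    simp_rw [fun β => ENNReal.ofReal_mul (mul_nonneg (h0 β) (invGamma11_nonneg hσ))
      (q := invGamma11 δ), fun β => ENNReal.ofReal_mul (h0 β) (q := invGamma11 σ)]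
    rw [lintegral_mul_const' _ _ ENNReal.ofReal_ne_top,
      lintegral_mul_const' _ _ ENNReal.ofReal_ne_top,
      ENNReal.ofReal_mul (by positivity), ← mul_assoc]
    gcongr
    exact lintegral_prod_fTPSC_le X y e he hw hσ hδ
  calc _ ≤ ∫⁻ w in Set.Ioo (0 : ℝ) 1, C * J * I := by
        refine setLIntegral_mono' measurableSet_Ioo fun w hw => ?_
        rw [← lintegral_const_mul' _ _ hC, ← lintegral_mul_const' _ _ hI]
        refine setLIntegral_mono' measurableSet_Ioi fun σ hσ => ?_
        rw [← lintegral_const_mul' _ _ (ENNReal.mul_ne_top hC ENNReal.ofReal_ne_top)]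
        exact setLIntegral_mono' measurableSet_Ioi fun δ hδ => hβ w hw σ hσ δ hδ
    _ < ⊤ := by
        simpa using (ENNReal.mul_ne_top (ENNReal.mul_ne_top hC hJ) hI).lt_top
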